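/- Let M be Haar distributed on U(n) and i, j ≥ 1. Then E[Tr(M^i) conj(Tr(M^j))] = δ_{ij} · min(j, n). -/

import Mathlib

open MeasureTheory Matrix

namespace HaarUnitary

/-- The coefficients of `exp (c * ∑ k ≥ 1, p k * t ^ k / k)`, given by Newton's recursion. For
`c = 1` these are the complete symmetric functions `h r` in terms of power sums, and for `c = -1`
the signed elementary symmetric functions `(-1) ^ r * e r`. -/
noncomputable def newtonCoeff (c : ℂ) (p : ℕ → ℂ) : ℕ → ℂ
  | 0 => 1
  | r + 1 => c / (r + 1) * ∑ k : Fin (r + 1), p (k + 1) * newtonCoeff c p (r - k)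

lemma newtonCoeff_zero (c : ℂ) (p : ℕ → ℂ) : newtonCoeff c p 0 = 1 := by
  simp [newtonCoeff]

lemma mul_newtonCoeff (c : ℂ) (p : ℕ → ℂ) (r : ℕ) :
    (r : ℂ) * newtonCoeff c p r =
      c * ∑ k ∈ Finset.range r, p (k + 1) * newtonCoeff c p (r - 1 - k) := by
  cases r with
  | zero => simp
  | succ r =>
    have hr : (r : ℂ) + 1 ≠ 0 := Nat.cast_add_one_ne_zero r
    rw [newtonCoeff, Fin.sum_univ_eq_sum_range (fun k => p (k + 1) * newtonCoeff c p (r - k))]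
    push_cast
    field_simp

lemma sum_triangle_comm {A : Type*} [AddCommMonoid A] (r : ℕ) (f : ℕ → ℕ → A) :
    ∑ k ∈ Finset.range r, ∑ l ∈ Finset.range (r - 1 - k), f k l =
      ∑ l ∈ Finset.range r, ∑ k ∈ Finset.range (r - 1 - l), f k l :=
  Finset.sum_comm' fun k l => by simp only [Finset.mem_range]; omega

lemma sum_triangle_diagonal {A : Type*} [AddCommMonoid A] (r : ℕ) (f : ℕ → ℕ → A) :
    ∑ m ∈ Finset.range r, ∑ k ∈ Finset.range m, f k (m - 1 - k) =
      ∑ k ∈ Finset.range r, ∑ l ∈ Finset.range (r - 1 - k), f k l := by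
  rw [Finset.sum_sigma', Finset.sum_sigma']
  refine Finset.sum_bij' (fun x _ => ⟨x.2, x.1 - 1 - x.2⟩) (fun x _ => ⟨x.1 + x.2 + 1, x.1⟩)
    ?_ ?_ ?_ ?_ ?_
  · rintro ⟨m, k⟩ h
    simp only [Finset.mem_sigma, Finset.mem_range] at h ⊢
    omega
  · rintro ⟨m, k⟩ h
    simp only [Finset.mem_sigma, Finset.mem_range] at h ⊢
    omega
  · rintro ⟨m, k⟩ h
    simp only [Finset.mem_sigma, Finset.mem_range] at h
    have : k + (m - 1 - k) + 1 = m := by omega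
    simp [this]
  · rintro ⟨k, l⟩ h
    simp
  · simp

/-- Newton coefficients for `c = ± 1` are eigenfunctions of the Laplacian in power-sum form. -/
lemma newtonCoeff_laplacian {c : ℂ} (hc : c * c = 1) (p : ℕ → ℂ) (r : ℕ) :
    c * (∑ k ∈ Finset.range r, newtonCoeff c p (r - 1 - k) *
        ∑ i ∈ Finset.range (k + 1), p i * p (k + 1 - i)) +
      c * (c * ∑ k ∈ Finset.range r, ∑ l ∈ Finset.range (r - 1 - k),
        p (k + l + 2) * newtonCoeff c p (r - 1 - k - 1 - l)) =
    r * (p 0 + c * (r - 1)) * newtonCoeff c p r := by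
  set s := newtonCoeff c p with hs
  have hfst : ∑ k ∈ Finset.range r, s (r - 1 - k) * ∑ i ∈ Finset.range (k + 1), p i * p (k + 1 - i)
      = p 0 * ∑ k ∈ Finset.range r, p (k + 1) * s (r - 1 - k) +
        ∑ i ∈ Finset.range r, p (i + 1) *
          ∑ l ∈ Finset.range (r - 1 - i), p (l + 1) * s (r - 1 - i - 1 - l) := by
    simp only [Finset.sum_range_succ', Finset.mul_sum, mul_add, Finset.sum_add_distrib]
    rw [add_comm]
    congr 1
    · exact Finset.sum_congr rfl fun k _ => by simp only [Nat.sub_zero]; ring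
    · rw [← sum_triangle_diagonal r
        fun i l => p (i + 1) * (p (l + 1) * s (r - 1 - i - 1 - l))]
      refine Finset.sum_congr rfl fun k _ => Finset.sum_congr rfl fun i hi => ?_
      have hi := Finset.mem_range.1 hi
      have e₁ : k + 1 - (i + 1) = k - 1 - i + 1 := by omega
      have e₂ : r - 1 - i - 1 - (k - 1 - i) = r - 1 - k := by omega
      rw [e₁, e₂]
      ring
  have hsnd : ∑ k ∈ Finset.range r, ∑ l ∈ Finset.range (r - 1 - k),
      p (k + l + 2) * s (r - 1 - k - 1 - l) =
        ∑ m ∈ Finset.range r, (m : ℂ) * (p (m + 1) * s (r - 1 - m)) := by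
    rw [← sum_triangle_diagonal r fun k l => p (k + l + 2) * s (r - 1 - k - 1 - l)]
    refine Finset.sum_congr rfl fun m _ => ?_
    rw [Finset.sum_congr rfl (g := fun _ => p (m + 1) * s (r - 1 - m))]
    · simp
    · intro k hk
      have hk := Finset.mem_range.1 hk
      have e₁ : k + (m - 1 - k) + 2 = m + 1 := by omega
      have e₂ : r - 1 - k - 1 - (m - 1 - k) = r - 1 - m := by omega
      rw [e₁, e₂]
  have hinner : c * ∑ i ∈ Finset.range r, p (i + 1) *
      ∑ l ∈ Finset.range (r - 1 - i), p (l + 1) * s (r - 1 - i - 1 - l) =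
      ∑ i ∈ Finset.range r, ((r : ℂ) - 1 - i) * (p (i + 1) * s (r - 1 - i)) := by
    rw [Finset.mul_sum]
    refine Finset.sum_congr rfl fun i hi => ?_
    have hi := Finset.mem_range.1 hi
    have h := mul_newtonCoeff c p (r - 1 - i)
    rw [← hs, Nat.cast_sub (by omega), Nat.cast_sub (by omega), Nat.cast_one] at h
    linear_combination (-p (i + 1)) * h
  have hcomb : ∑ i ∈ Finset.range r, ((r : ℂ) - 1 - i) * (p (i + 1) * s (r - 1 - i)) +
      ∑ m ∈ Finset.range r, (m : ℂ) * (p (m + 1) * s (r - 1 - m)) =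
      (r - 1) * ∑ k ∈ Finset.range r, p (k + 1) * s (r - 1 - k) := by
    rw [← Finset.sum_add_distrib, Finset.mul_sum]
    exact Finset.sum_congr rfl fun _ _ => by ring
  have hN := mul_newtonCoeff c p r
  rw [← hs] at hN
  rw [hfst, hsnd]
  linear_combination hinner + hcomb - (p 0 + c * (r - 1)) * hN +
    (∑ m ∈ Finset.range r, (m : ℂ) * (p (m + 1) * s (r - 1 - m)) -
      (r - 1) * ∑ k ∈ Finset.range r, p (k + 1) * s (r - 1 - k)) * hc

open PowerSeries in
lemma derivative_mk_newtonCoeff (c : ℂ) (p : ℕ → ℂ) :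
    d⁄dX ℂ (PowerSeries.mk (newtonCoeff c p)) =
      c • (PowerSeries.mk (fun k => p (k + 1)) * PowerSeries.mk (newtonCoeff c p)) := by
  ext r
  rw [coeff_derivative, coeff_smul, coeff_mul,
    Finset.Nat.sum_antidiagonal_eq_sum_range_succ_mk]
  simp only [coeff_mk]
  have h := mul_newtonCoeff c p (r + 1)
  push_cast at h
  rw [mul_comm, h]
  simp

open PowerSeries in
lemma mk_newtonCoeff_neg_one_mul_mk_newtonCoeff_one (p : ℕ → ℂ) :
    PowerSeries.mk (newtonCoeff (-1) p) * PowerSeries.mk (newtonCoeff 1 p) = 1 := by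
  apply derivative.ext
  · rw [Derivation.leibniz, derivative_mk_newtonCoeff, derivative_mk_newtonCoeff, derivative_one]
    simp only [smul_eq_mul, one_smul, neg_smul]
    ring
  · simp [newtonCoeff_zero]

/-- The alternating hook expansion of a power sum, shifted by a multiple of `∑ e r * h (j - r)`. -/
lemma sum_sub_mul_newtonCoeff (p : ℕ → ℂ) (a : ℂ) {j : ℕ} (hj : 1 ≤ j) :
    ∑ r ∈ Finset.range (j + 1), (a - r) * (newtonCoeff (-1) p r * newtonCoeff 1 p (j - r)) =
      p j := by
  obtain ⟨m, rfl⟩ : ∃ m, j = m + 1 := ⟨j - 1, by omega⟩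
  have hmul := mk_newtonCoeff_neg_one_mul_mk_newtonCoeff_one p
  have h₀ := congrArg (PowerSeries.coeff (m + 1)) hmul
  have h₁ : PowerSeries.derivative ℂ (PowerSeries.mk (newtonCoeff (-1) p)) *
      PowerSeries.mk (newtonCoeff 1 p) = -PowerSeries.mk (fun k => p (k + 1)) := by
    rw [derivative_mk_newtonCoeff, neg_one_smul, neg_mul, mul_assoc, hmul, mul_one]
  have h₁ := congrArg (PowerSeries.coeff m) h₁
  rw [PowerSeries.coeff_mul, Finset.Nat.sum_antidiagonal_eq_sum_range_succ_mk] at h₀ h₁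
  simp only [PowerSeries.coeff_mk, PowerSeries.coeff_one, PowerSeries.coeff_derivative,
    map_neg] at h₀ h₁
  simp only [sub_mul, Finset.sum_sub_distrib, ← Finset.mul_sum, h₀]
  rw [Finset.sum_range_succ']
  simp only [Nat.cast_zero, Nat.add_sub_add_right, zero_mul, add_zero]
  rw [Finset.sum_congr rfl (g := fun r => newtonCoeff (-1) p (r + 1) * ((r : ℂ) + 1) *
    newtonCoeff 1 p (m - r)) fun r _ => by push_cast; ring, h₁]
  simp

variable {n : ℕ}

instance compactSpace : CompactSpace (unitaryGroup (Fin n) ℂ) := by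
  suffices h : IsCompact (unitaryGroup (Fin n) ℂ : Set (Matrix (Fin n) (Fin n) ℂ)) from
    isCompact_iff_compactSpace.1 h
  have hbox : IsCompact (Set.pi Set.univ fun _ : Fin n => Set.pi Set.univ fun _ : Fin n =>
      Metric.closedBall (0 : ℂ) 1) :=
    isCompact_univ_pi fun _ => isCompact_univ_pi fun _ => isCompact_closedBall 0 1
  refine hbox.of_isClosed_subset (isClosed_unitary (R := Matrix (Fin n) (Fin n) ℂ)) ?_
  intro U hU i _ j _
  simpa using entry_norm_bound_of_unitary hU i j

lemma exp_smul_mem_unitaryGroup (X : skewAdjoint (Matrix (Fin n) (Fin n) ℂ)) (t : ℝ) :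
    NormedSpace.exp (t • X.1) ∈ unitaryGroup (Fin n) ℂ := by
  rw [mem_unitaryGroup_iff, star_eq_conjTranspose, ← exp_conjTranspose,
    ← star_eq_conjTranspose, skewAdjoint.mem_iff.1 (skewAdjoint.smul_mem t X.2),
    ← exp_add_of_commute _ _ (Commute.refl (t • X.1)).neg_right, add_neg_cancel,
    NormedSpace.exp_zero]

/-- The one-parameter subgroup of the unitary group generated by a skew-Hermitian matrix. -/
noncomputable def expFlow (X : skewAdjoint (Matrix (Fin n) (Fin n) ℂ)) (t : ℝ) :
    unitaryGroup (Fin n) ℂ :=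
  ⟨NormedSpace.exp (t • (X : Matrix (Fin n) (Fin n) ℂ)),
    exp_smul_mem_unitaryGroup X t⟩

lemma expFlow_zero (X : skewAdjoint (Matrix (Fin n) (Fin n) ℂ)) : expFlow X 0 = 1 := by
  ext1; simp [expFlow]

lemma expFlow_add (X : skewAdjoint (Matrix (Fin n) (Fin n) ℂ)) (s t : ℝ) :
    expFlow X (s + t) = expFlow X s * expFlow X t := by
  apply Subtype.ext
  simp only [expFlow, add_smul]
  exact exp_add_of_commute _ _ (((Commute.refl X.1).smul_left s).smul_right t)

open scoped Matrix.Norms.Operator in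
lemma hasDerivAt_expFlow_entry (X : skewAdjoint (Matrix (Fin n) (Fin n) ℂ))
    (M : unitaryGroup (Fin n) ℂ) (x y : Fin n) :
    HasDerivAt (fun t : ℝ => (expFlow X t * M : unitaryGroup (Fin n) ℂ).1 x y)
      ((X.1 * M.1) x y) 0 := by
  have h := (hasDerivAt_exp_smul_const (𝕂 := ℝ) (X : Matrix (Fin n) (Fin n) ℂ) 0).mul_const M.1
  have h' := hasDerivAt_pi.1 (hasDerivAt_pi.1 h x) y
  convert! h' using 1
  simp

/-- `N` is the gradient of `f` along left translations: the derivative of `f` in the direction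
`X * M`, for skew-Hermitian `X`, is `trace (X * N M)`. -/
def HasGrad (f : unitaryGroup (Fin n) ℂ → ℂ)
    (N : unitaryGroup (Fin n) ℂ → Matrix (Fin n) (Fin n) ℂ) : Prop :=
  Continuous f ∧ Continuous N ∧ ∀ (X : skewAdjoint (Matrix (Fin n) (Fin n) ℂ)) M,
    HasDerivAt (fun t : ℝ => f (expFlow X t * M)) (trace (X.1 * N M)) 0

namespace HasGrad

variable {f g : unitaryGroup (Fin n) ℂ → ℂ}
  {N K : unitaryGroup (Fin n) ℂ → Matrix (Fin n) (Fin n) ℂ}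

lemma const (c : ℂ) : HasGrad (n := n) (fun _ => c) (fun _ => 0) :=
  ⟨continuous_const, continuous_const, fun X M => by simpa using hasDerivAt_const (0 : ℝ) c⟩

lemma mul (hf : HasGrad f N) (hg : HasGrad g K) :
    HasGrad (fun M => f M * g M) (fun M => g M • N M + f M • K M) := by
  refine ⟨hf.1.mul hg.1, (hg.1.smul hf.2.1).add (hf.1.smul hg.2.1), fun X M => ?_⟩
  convert! (hf.2.2 X M).mul (hg.2.2 X M) using 1
  simp [mul_add, expFlow_zero, mul_comm]

lemma const_mul (c : ℂ) (hf : HasGrad f N) : HasGrad (fun M => c * f M) (fun M => c • N M) := by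
  simpa using (HasGrad.const c).mul hf

lemma sum {ι : Type*} (s : Finset ι) {f : ι → unitaryGroup (Fin n) ℂ → ℂ}
    {N : ι → unitaryGroup (Fin n) ℂ → Matrix (Fin n) (Fin n) ℂ}
    (h : ∀ i ∈ s, HasGrad (f i) (N i)) :
    HasGrad (fun M => ∑ i ∈ s, f i M) (fun M => ∑ i ∈ s, N i M) := by
  refine ⟨continuous_finsetSum s fun i hi => (h i hi).1,
    continuous_finsetSum s fun i hi => (h i hi).2.1, fun X M => ?_⟩
  simpa [Finset.mul_sum, trace_sum] using HasDerivAt.fun_sum fun i hi => (h i hi).2.2 X M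

lemma conj (hf : HasGrad f N) :
    HasGrad (fun M => (starRingEnd ℂ) (f M)) (fun M => -(N M)ᴴ) := by
  refine ⟨Complex.continuous_conj.comp hf.1, hf.2.1.matrix_conjTranspose.neg, fun X M => ?_⟩
  convert! (hf.2.2 X M).star using 1
  have hX : (X.1)ᴴ = -X.1 := skewAdjoint.mem_iff.1 X.2
  rw [← trace_conjTranspose, conjTranspose_mul, hX, trace_mul_comm]
  simp

/-- The gradient of an entry of a power of the identity representation. -/
lemma pow_entry (k : ℕ) (x y : Fin n) :
    HasGrad (fun M : unitaryGroup (Fin n) ℂ => (M.1 ^ k) x y)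
      (fun M => ∑ i ∈ Finset.range k, M.1 ^ (k - i) * single y x 1 * M.1 ^ i) := by
  have hc : Continuous fun M : unitaryGroup (Fin n) ℂ => M.1 := continuous_subtype_val
  refine ⟨(hc.pow k).matrix_elem x y, continuous_finsetSum _ fun i _ =>
    ((hc.pow _).mul continuous_const).mul (hc.pow _), fun X M => ?_⟩
  have key : ∀ (A B : Matrix (Fin n) (Fin n) ℂ) (x y : Fin n),
      trace (X.1 * (A * single y x 1 * B)) = (B * X.1 * A) x y := by
    intro A B x y
    rw [← mul_assoc, trace_mul_comm, ← mul_assoc, ← mul_assoc, trace_mul_single]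
    simp
  simp only [Finset.mul_sum, trace_sum, key]
  induction k generalizing x y with
  | zero => simpa using hasDerivAt_const (0 : ℝ) ((1 : Matrix (Fin n) (Fin n) ℂ) x y)
  | succ k ih =>
    have h := HasDerivAt.fun_sum (u := Finset.univ) fun z _ =>
      (ih x z).mul (hasDerivAt_expFlow_entry X M z y)
    have hfun : (fun t : ℝ => ((expFlow X t * M : unitaryGroup (Fin n) ℂ).1 ^ (k + 1)) x y) =
        fun t => ∑ z, ((expFlow X t * M : unitaryGroup (Fin n) ℂ).1 ^ k) x z *
          (expFlow X t * M : unitaryGroup (Fin n) ℂ).1 z y := by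
      funext t
      rw [pow_succ, mul_apply]
    rw [hfun]
    convert! h using 1
    simp only [expFlow_zero, one_mul, Finset.sum_add_distrib, Finset.sum_range_succ]
    congr 1
    · simp only [Finset.sum_mul]
      rw [Finset.sum_comm]
      refine Finset.sum_congr rfl fun i hi => ?_
      rw [← mul_apply, mul_assoc _ _ M.1, ← pow_succ,
        Nat.sub_add_comm (Finset.mem_range.1 hi).le]
    · rw [← mul_apply, Nat.add_sub_cancel_left, pow_one, mul_assoc]

lemma trace_pow (k : ℕ) :
    HasGrad (fun M : unitaryGroup (Fin n) ℂ => trace (M.1 ^ k)) (fun M => (k : ℂ) • M.1 ^ k) := by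
  have h := HasGrad.sum Finset.univ fun (x : Fin n) _ => pow_entry k x x
  convert! h using 1
  funext M
  rw [Finset.sum_comm]
  have hi : ∀ i ∈ Finset.range k,
      ∑ x : Fin n, M.1 ^ (k - i) * single x x (1 : ℂ) * M.1 ^ i = M.1 ^ k := by
    intro i hi
    rw [← Finset.sum_mul, ← Finset.mul_sum, sum_single_one, mul_one, ← pow_add,
      Nat.sub_add_cancel (Finset.mem_range.1 hi).le]
  rw [Finset.sum_congr rfl hi, Finset.sum_const, Finset.card_range, Nat.cast_smul_eq_nsmul]

end HasGrad

section Integration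

variable [MeasurableSpace (unitaryGroup (Fin n) ℂ)] [BorelSpace (unitaryGroup (Fin n) ℂ)]
  (μ : Measure (unitaryGroup (Fin n) ℂ)) [IsProbabilityMeasure μ]

lemma integrable_of_continuous {f : unitaryGroup (Fin n) ℂ → ℂ} (hf : Continuous f) :
    Integrable f μ :=
  hf.integrable_of_hasCompactSupport (HasCompactSupport.of_compactSpace f)

variable {f w : unitaryGroup (Fin n) ℂ → ℂ}
  {N W : unitaryGroup (Fin n) ℂ → Matrix (Fin n) (Fin n) ℂ}

lemma HasGrad.integrable_trace_mul (hf : HasGrad f N) (X : Matrix (Fin n) (Fin n) ℂ) :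
    Integrable (fun M => trace (X * N M)) μ :=
  integrable_of_continuous μ (continuous_const.mul hf.2.1).matrix_trace

variable [μ.IsMulLeftInvariant]

lemma HasGrad.integral_trace_mul_eq_zero_of_skewAdjoint (hf : HasGrad f N)
    (X : skewAdjoint (Matrix (Fin n) (Fin n) ℂ)) : ∫ M, trace (X.1 * N M) ∂μ = 0 := by
  have hN : Continuous fun M => trace (X.1 * N M) := (continuous_const.mul hf.2.1).matrix_trace
  obtain ⟨C, hC⟩ := isCompact_univ.exists_bound_of_continuousOn hN.continuousOn
  have hderiv : ∀ (M : unitaryGroup (Fin n) ℂ) (t : ℝ),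
      HasDerivAt (fun t => f (expFlow X t * M)) (trace (X.1 * N (expFlow X t * M))) t := by
    intro M t
    have h := HasDerivAt.comp_sub_const t t
      (by simpa only [sub_self] using hf.2.2 X (expFlow X t * M))
    simpa only [← mul_assoc, ← expFlow_add, sub_add_cancel] using h
  have h := (hasDerivAt_integral_of_dominated_loc_of_deriv_le (μ := μ) (x₀ := (0 : ℝ))
    (s := Set.univ) (F := fun t M => f (expFlow X t * M))
    (F' := fun t M => trace (X.1 * N (expFlow X t * M))) (bound := fun _ => C) Filter.univ_mem
    (Filter.Eventually.of_forall fun t => (integrable_of_continuous μ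
      (hf.1.comp (continuous_const.mul continuous_id))).aestronglyMeasurable)
    (integrable_of_continuous μ (hf.1.comp (continuous_const.mul continuous_id)))
    (integrable_of_continuous μ
      (hN.comp (continuous_const.mul continuous_id))).aestronglyMeasurable
    (Filter.Eventually.of_forall fun M t _ => hC _ (Set.mem_univ _))
    (integrable_const C) (Filter.Eventually.of_forall fun M t _ => hderiv M t)).2
  simp only [integral_mul_left_eq_self f, expFlow_zero, one_mul] at h
  exact h.unique (hasDerivAt_const _ _)

lemma HasGrad.integral_trace_mul_eq_zero (hf : HasGrad f N) (X : Matrix (Fin n) (Fin n) ℂ) :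
    ∫ M, trace (X * N M) ∂μ = 0 := by
  have hskew : ∀ H : selfAdjoint (Matrix (Fin n) (Fin n) ℂ),
      ∫ M, trace (H.1 * N M) ∂μ = 0 := by
    intro H
    have h := hf.integral_trace_mul_eq_zero_of_skewAdjoint μ
      ⟨Complex.I • H.1, IsSelfAdjoint.smul_mem_skewAdjoint Complex.conj_I H.2⟩
    simpa [integral_const_mul] using h
  rw [← realPart_add_I_smul_imaginaryPart X]
  simp only [add_mul, trace_add, smul_mul_assoc, trace_smul, smul_eq_mul]
  rw [integral_add (hf.integrable_trace_mul μ _) ((hf.integrable_trace_mul μ _).const_mul _),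
    integral_const_mul, hskew, hskew]
  simp

/-- The divergence theorem on the unitary group for the vector field `w • M ^ k`. -/
lemma HasGrad.integral_divergence (hw : HasGrad w W) (k : ℕ) :
    ∫ M, (w M * ∑ i ∈ Finset.range k, trace (M.1 ^ i) * trace (M.1 ^ (k - i)) +
      trace (W M * M.1 ^ k)) ∂μ = 0 := by
  have h := fun x y : Fin n =>
    (hw.mul (HasGrad.pow_entry k x y)).integral_trace_mul_eq_zero μ (single x y 1)
  have hinteg := fun x y : Fin n =>
    (hw.mul (HasGrad.pow_entry k x y)).integrable_trace_mul μ (single x y 1)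
  calc
    _ = ∫ M, ∑ x : Fin n, ∑ y : Fin n, trace (single x y (1 : ℂ) *
        ((M.1 ^ k) x y • W M + w M • ∑ i ∈ Finset.range k,
          M.1 ^ (k - i) * single y x 1 * M.1 ^ i)) ∂μ := by
      congr 1
      funext M
      have hentry : ∀ (i : ℕ) (x y : Fin n),
          (M.1 ^ (k - i) * single y x 1 * M.1 ^ i : Matrix (Fin n) (Fin n) ℂ) y x =
            (M.1 ^ i) x x * (M.1 ^ (k - i)) y y := by
        intro i x y
        rw [mul_assoc, mul_apply, Finset.sum_eq_single y]
        · simp [mul_comm]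
        · intro z _ hz
          simp [hz]
        · simp
      simp only [trace_single_mul, one_mul, Matrix.add_apply, Matrix.smul_apply, Matrix.sum_apply,
        hentry, smul_eq_mul, Finset.sum_add_distrib]
      rw [add_comm]
      congr 1
      · rw [trace_mul_comm]
        simp [trace, mul_apply]
      · simp only [← Finset.mul_sum]
        congr 1
        simp only [trace, diag_apply, Finset.sum_mul_sum]
        rw [Finset.sum_comm]
        refine Finset.sum_congr rfl fun x _ => ?_
        rw [Finset.sum_comm]
    _ = 0 := by
      rw [integral_finsetSum _ fun x _ => integrable_finsetSum _ fun y _ => hinteg x y]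
      refine Finset.sum_eq_zero fun x _ => ?_
      rw [integral_finsetSum _ fun y _ => hinteg x y]
      exact Finset.sum_eq_zero fun y _ => h x y

end Integration

section NewtonTrace

/-- The Newton coefficients of the power sums `trace (M ^ k)`. -/
noncomputable def newtonTrace (c : ℂ) (r : ℕ) (M : unitaryGroup (Fin n) ℂ) : ℂ :=
  newtonCoeff c (fun k => trace (M.1 ^ k)) r

/-- The gradient of `newtonTrace c r`. -/
noncomputable def newtonGrad (c : ℂ) (r : ℕ) (M : unitaryGroup (Fin n) ℂ) :
    Matrix (Fin n) (Fin n) ℂ :=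
  c • ∑ k ∈ Finset.range r, newtonTrace c (r - 1 - k) M • M.1 ^ (k + 1)

lemma newtonTrace_zero (c : ℂ) (M : unitaryGroup (Fin n) ℂ) : newtonTrace c 0 M = 1 :=
  newtonCoeff_zero _ _

lemma mul_newtonTrace (c : ℂ) (r : ℕ) (M : unitaryGroup (Fin n) ℂ) :
    (r : ℂ) * newtonTrace c r M =
      c * ∑ k ∈ Finset.range r, trace (M.1 ^ (k + 1)) * newtonTrace c (r - 1 - k) M :=
  mul_newtonCoeff _ _ _

lemma trace_newtonGrad (c : ℂ) (r : ℕ) (M : unitaryGroup (Fin n) ℂ) :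
    trace (newtonGrad c r M) = r * newtonTrace c r M := by
  rw [mul_newtonTrace]
  simp [newtonGrad, trace_sum, mul_comm]

lemma hasGrad_newtonTrace (c : ℂ) (r : ℕ) :
    HasGrad (n := n) (newtonTrace c r) (newtonGrad c r) := by
  induction r using Nat.strong_induction_on with
  | h r ih =>
    rcases Nat.eq_zero_or_pos r with rfl | hr
    · convert! HasGrad.const (n := n) 1 using 1
      · funext M; exact newtonTrace_zero c M
      · funext M; simp [newtonGrad]
    · have hr' : (r : ℂ) ≠ 0 := Nat.cast_ne_zero.2 hr.ne'
      have h := ((HasGrad.sum (Finset.range r) fun k hk =>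
        (HasGrad.trace_pow (n := n) (k + 1)).mul
          (ih (r - 1 - k) (by have := Finset.mem_range.1 hk; omega))).const_mul c).const_mul
            (r : ℂ)⁻¹
      convert! h using 1
      · funext M
        rw [← mul_newtonTrace, inv_mul_cancel_left₀ hr']
      · funext M
        rw [eq_inv_smul_iff₀ hr', newtonGrad, smul_comm]
        congr 1
        have hswap : ∑ k ∈ Finset.range r, trace (M.1 ^ (k + 1)) • newtonGrad c (r - 1 - k) M =
            ∑ l ∈ Finset.range r,
              (((r : ℂ) - 1 - l) * newtonTrace c (r - 1 - l) M) • M.1 ^ (l + 1) := by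
          simp only [newtonGrad, Finset.smul_sum, smul_smul]
          rw [sum_triangle_comm]
          refine Finset.sum_congr rfl fun l hl => ?_
          have hl := Finset.mem_range.1 hl
          have hN := mul_newtonTrace c (r - 1 - l) M
          rw [Nat.cast_sub (by omega), Nat.cast_sub (by omega), Nat.cast_one] at hN
          rw [hN, ← Finset.sum_smul, Finset.mul_sum]
          congr 1
          refine Finset.sum_congr rfl fun k _ => ?_
          rw [Nat.sub_right_comm (r - 1 - k), Nat.sub_right_comm (r - 1) k,
            Nat.sub_right_comm (r - 1 - l) k]
          ring
        rw [Finset.sum_add_distrib, hswap, ← Finset.sum_add_distrib, Finset.smul_sum]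
        refine Finset.sum_congr rfl fun k _ => ?_
        rw [smul_smul, smul_smul, ← add_smul]
        congr 1
        push_cast
        ring

lemma trace_newtonGrad_mul_newtonGrad (c d : ℂ) (r a : ℕ) (M : unitaryGroup (Fin n) ℂ) :
    trace (newtonGrad c r M * newtonGrad d a M) =
      c * d * ∑ k ∈ Finset.range r, ∑ l ∈ Finset.range a,
        trace (M.1 ^ (k + l + 2)) *
          (newtonTrace c (r - 1 - k) M * newtonTrace d (a - 1 - l) M) := by
  simp only [newtonGrad, smul_mul_smul_comm, Finset.sum_mul_sum, trace_smul, trace_sum, smul_eq_mul]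
  congr 1
  refine Finset.sum_congr rfl fun k _ => Finset.sum_congr rfl fun l _ => ?_
  rw [← pow_add, mul_comm, show k + 1 + (l + 1) = k + l + 2 by ring]

/-- Pieri-type relation between the carré-du-champ terms of neighbouring degrees. -/
lemma trace_newtonGrad_succ_mul (r a : ℕ) (M : unitaryGroup (Fin n) ℂ) :
    trace (newtonGrad (-1) (r + 1) M * newtonGrad 1 a M) +
        (r + 1) * newtonTrace (-1) (r + 1) M * newtonTrace 1 a M =
      trace (newtonGrad (-1) r M * newtonGrad 1 (a + 1) M) -
        (a + 1) * newtonTrace (-1) r M * newtonTrace 1 (a + 1) M := by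
  have hr := mul_newtonTrace (-1) (r + 1) M
  have ha := mul_newtonTrace 1 (a + 1) M
  push_cast at hr ha
  have h₁ : ∑ k ∈ Finset.range (r + 1), ∑ l ∈ Finset.range (a + 1),
      trace (M.1 ^ (k + l + 1)) * (newtonTrace (-1) (r - k) M * newtonTrace 1 (a - l) M) =
      ∑ k ∈ Finset.range (r + 1), ∑ l ∈ Finset.range a,
        trace (M.1 ^ (k + l + 2)) * (newtonTrace (-1) (r - k) M * newtonTrace 1 (a - 1 - l) M) +
      (∑ k ∈ Finset.range (r + 1), trace (M.1 ^ (k + 1)) * newtonTrace (-1) (r - k) M) *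
        newtonTrace 1 a M := by
    rw [Finset.sum_mul, ← Finset.sum_add_distrib]
    refine Finset.sum_congr rfl fun k _ => ?_
    rw [Finset.sum_range_succ']
    simp only [Nat.sub_sub, add_comm 1, add_zero, Nat.sub_zero, add_assoc, Nat.reduceAdd, mul_assoc]
  have h₂ : ∑ k ∈ Finset.range (r + 1), ∑ l ∈ Finset.range (a + 1),
      trace (M.1 ^ (k + l + 1)) * (newtonTrace (-1) (r - k) M * newtonTrace 1 (a - l) M) =
      ∑ k ∈ Finset.range r, ∑ l ∈ Finset.range (a + 1),
        trace (M.1 ^ (k + l + 2)) * (newtonTrace (-1) (r - 1 - k) M * newtonTrace 1 (a - l) M) +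
      newtonTrace (-1) r M *
        ∑ l ∈ Finset.range (a + 1), trace (M.1 ^ (l + 1)) * newtonTrace 1 (a - l) M := by
    rw [Finset.sum_range_succ', Finset.mul_sum]
    congr 1
    · refine Finset.sum_congr rfl fun k _ => Finset.sum_congr rfl fun l _ => ?_
      rw [Nat.sub_sub, add_comm 1, show k + 1 + l + 1 = k + l + 2 by ring]
    · refine Finset.sum_congr rfl fun l _ => ?_
      rw [zero_add, Nat.sub_zero]
      ring
  rw [trace_newtonGrad_mul_newtonGrad, trace_newtonGrad_mul_newtonGrad]
  simp only [Nat.add_sub_cancel]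
  linear_combination h₁ - h₂ + newtonTrace 1 a M * hr + newtonTrace (-1) r M * ha

/-- The integrand `newtonTrace c r * newtonTrace d a * conj (trace (M ^ (r + a)))`. -/
noncomputable def hookIntegrand (c d : ℂ) (r a : ℕ) (M : unitaryGroup (Fin n) ℂ) : ℂ :=
  newtonTrace c r M * newtonTrace d a M * (starRingEnd ℂ) (trace (M.1 ^ (r + a)))

lemma hookIntegrand_comm (c d : ℂ) (r a : ℕ) (M : unitaryGroup (Fin n) ℂ) :
    hookIntegrand c d r a M = hookIntegrand d c a r M := by
  rw [hookIntegrand, hookIntegrand, add_comm a r, mul_comm (newtonTrace c r M)]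

lemma continuous_hookIntegrand (c d : ℂ) (r a : ℕ) :
    Continuous (hookIntegrand (n := n) c d r a) :=
  (((hasGrad_newtonTrace c r).mul (hasGrad_newtonTrace d a)).mul (HasGrad.trace_pow _).conj).1

lemma trace_pow_mul_conjTranspose_pow (M : unitaryGroup (Fin n) ℂ) (k m : ℕ) :
    trace (M.1 ^ k * (M.1 ^ (m + k))ᴴ) = (starRingEnd ℂ) (trace (M.1 ^ m)) := by
  have h : M.1 ^ k * (M.1 ^ k)ᴴ = 1 := mem_unitaryGroup_iff.1 (pow_mem M.2 k)
  rw [pow_add, conjTranspose_mul, ← mul_assoc, h, one_mul, trace_conjTranspose]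
  rfl

variable [MeasurableSpace (unitaryGroup (Fin n) ℂ)] [BorelSpace (unitaryGroup (Fin n) ℂ)]
  (μ : Measure (unitaryGroup (Fin n) ℂ)) [IsProbabilityMeasure μ] [μ.IsMulLeftInvariant]

/-- Green's formula for the Laplace eigenfunctions `newtonTrace c r`, `c = ± 1`. -/
lemma integral_newtonTrace_mul_add {c : ℂ} (hc : c * c = 1) (r : ℕ)
    {φ : unitaryGroup (Fin n) ℂ → ℂ} {Φ : unitaryGroup (Fin n) ℂ → Matrix (Fin n) (Fin n) ℂ}
    (hφ : HasGrad φ Φ) :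
    ∫ M, ((r : ℂ) * (n + c * (r - 1)) * newtonTrace c r M * φ M +
      trace (newtonGrad c r M * Φ M)) ∂μ = 0 := by
  have hgrad := fun k => ((hasGrad_newtonTrace (n := n) c (r - 1 - k)).mul hφ).const_mul c
  have hcont : ∀ k, Continuous fun M : unitaryGroup (Fin n) ℂ => trace (M.1 ^ k) :=
    fun k => (HasGrad.trace_pow k).1
  calc
    _ = ∫ M, ∑ k ∈ Finset.range r, (c * (newtonTrace c (r - 1 - k) M * φ M) *
          ∑ i ∈ Finset.range (k + 1), trace (M.1 ^ i) * trace (M.1 ^ (k + 1 - i)) +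
        trace ((c • (φ M • newtonGrad c (r - 1 - k) M + newtonTrace c (r - 1 - k) M • Φ M)) *
          M.1 ^ (k + 1))) ∂μ := by
      congr 1
      funext M
      have hL := newtonCoeff_laplacian hc (fun k => trace (M.1 ^ k)) r
      change c * (∑ k ∈ Finset.range r, newtonTrace c (r - 1 - k) M * _) +
        c * (c * ∑ k ∈ Finset.range r, ∑ l ∈ Finset.range (r - 1 - k),
          _ * newtonTrace c (r - 1 - k - 1 - l) M) = _ * newtonTrace c r M at hL
      simp only [pow_zero, trace_one, Fintype.card_fin] at hL
      rw [← hL]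
      have hΦ : trace (newtonGrad c r M * Φ M) = c * ∑ k ∈ Finset.range r,
          newtonTrace c (r - 1 - k) M * trace (Φ M * M.1 ^ (k + 1)) := by
        simp [newtonGrad, Finset.sum_mul, trace_sum, trace_mul_comm (Φ M)]
      have hG : ∀ k, trace (newtonGrad c (r - 1 - k) M * M.1 ^ (k + 1)) =
          c * ∑ l ∈ Finset.range (r - 1 - k),
            trace (M.1 ^ (k + l + 2)) * newtonTrace c (r - 1 - k - 1 - l) M := by
        intro k
        simp only [newtonGrad, smul_mul_assoc, Finset.sum_mul, trace_smul, trace_sum, smul_eq_mul]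
        congr 1
        refine Finset.sum_congr rfl fun l _ => ?_
        rw [← pow_add, mul_comm, show l + 1 + (k + 1) = k + l + 2 by ring]
      simp only [smul_mul_assoc, add_mul, trace_smul, trace_add, smul_eq_mul, hG, hΦ,
        Finset.sum_add_distrib, Finset.mul_sum, Finset.sum_mul, mul_add]
      rw [← add_assoc]
      congr 1
      · congr 1
        · exact Finset.sum_congr rfl fun _ _ => Finset.sum_congr rfl fun _ _ => by ring
        · exact Finset.sum_congr rfl fun _ _ => Finset.sum_congr rfl fun _ _ => by ring
    _ = 0 := by
      rw [integral_finsetSum]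
      · exact Finset.sum_eq_zero fun k _ => (hgrad k).integral_divergence μ (k + 1)
      · intro k _
        refine integrable_of_continuous μ (.add (.mul (hgrad k).1 ?_) ?_)
        · exact continuous_finsetSum _ fun i _ => (hcont i).mul (hcont _)
        · exact ((hgrad k).2.1.mul (continuous_subtype_val.pow _)).matrix_trace

lemma green_hookIntegrand {c : ℂ} (hc : c * c = 1) (d : ℂ) (r a : ℕ) :
    (r : ℂ) * (n + c * (r - 1)) * ∫ M, hookIntegrand c d r a M ∂μ +
      ∫ M, trace (newtonGrad c r M * newtonGrad d a M) *
        (starRingEnd ℂ) (trace (M.1 ^ (r + a))) ∂μ =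
    (r + a) * (c * ∑ k ∈ Finset.range r, ∫ M, hookIntegrand c d k a M ∂μ) := by
  have hp := (HasGrad.trace_pow (n := n) (r + a)).conj
  have h := integral_newtonTrace_mul_add μ hc r ((hasGrad_newtonTrace d a).mul hp)
  have hI := fun k => integrable_of_continuous μ (continuous_hookIntegrand (n := n) c d k a)
  have hΓ : Integrable (fun M => trace (newtonGrad c r M * newtonGrad d a M) *
      (starRingEnd ℂ) (trace (M.1 ^ (r + a)))) μ :=
    integrable_of_continuous μ ((((hasGrad_newtonTrace c r).2.1.mul
      (hasGrad_newtonTrace d a).2.1).matrix_trace).mul hp.1)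
  have hrw : ∀ M : unitaryGroup (Fin n) ℂ,
      (r : ℂ) * (n + c * (r - 1)) * newtonTrace c r M *
          (newtonTrace d a M * (starRingEnd ℂ) (trace (M.1 ^ (r + a)))) +
        trace (newtonGrad c r M *
          ((starRingEnd ℂ) (trace (M.1 ^ (r + a))) • newtonGrad d a M +
            newtonTrace d a M • -(((r + a : ℕ) : ℂ) • M.1 ^ (r + a))ᴴ)) =
      (r : ℂ) * (n + c * (r - 1)) * hookIntegrand c d r a M +
        trace (newtonGrad c r M * newtonGrad d a M) * (starRingEnd ℂ) (trace (M.1 ^ (r + a))) -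
        (r + a) * (c * ∑ k ∈ Finset.range r, hookIntegrand c d k a M) := by
    intro M
    have hconj : trace (newtonGrad c r M * (M.1 ^ (r + a))ᴴ) * newtonTrace d a M =
        c * ∑ k ∈ Finset.range r, hookIntegrand c d k a M := by
      rw [← Finset.sum_range_reflect]
      simp only [newtonGrad, smul_mul_assoc, Finset.sum_mul, trace_smul, trace_sum, smul_eq_mul,
        mul_assoc]
      congr 1
      refine Finset.sum_congr rfl fun k hk => ?_
      have hk := Finset.mem_range.1 hk
      rw [show r + a = r - 1 - k + a + (k + 1) by omega, trace_pow_mul_conjTranspose_pow,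
        hookIntegrand]
      ring
    rw [← hconj, hookIntegrand]
    simp only [mul_add, trace_add, mul_smul_comm, trace_smul, smul_eq_mul, conjTranspose_smul,
      mul_neg, trace_neg, Nat.cast_add, star_add, star_natCast]
    ring
  simp only [hrw] at h
  have hsum : Integrable (fun M => (r : ℂ) * (n + c * (r - 1)) * hookIntegrand c d r a M +
      trace (newtonGrad c r M * newtonGrad d a M) *
        (starRingEnd ℂ) (trace (M.1 ^ (r + a)))) μ := ((hI r).const_mul _).add hΓ
  rw [integral_sub hsum
      (((integrable_finsetSum _ fun k _ => hI k).const_mul _).const_mul _),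
    integral_add ((hI r).const_mul _) hΓ, integral_const_mul, integral_const_mul,
    integral_const_mul, integral_finsetSum _ fun k _ => hI k] at h
  exact sub_eq_zero.1 h

lemma hookIntegral_recurrence (r a : ℕ) :
    ((r : ℂ) + 1) * (n - r - 1) * ∫ M, hookIntegrand (-1) 1 (r + 1) a M ∂μ =
      (a + 1) * (n + a + 1) * ∫ M, hookIntegrand (-1) 1 r (a + 1) M ∂μ -
      (r + a + 1) * (∑ k ∈ Finset.range (r + 1), ∫ M, hookIntegrand (-1) 1 k a M ∂μ +
        ∑ l ∈ Finset.range (a + 1), ∫ M, hookIntegrand (-1) 1 r l M ∂μ) := by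
  have h₁ := green_hookIntegrand μ (c := -1) (by norm_num) 1 (r + 1) a
  have h₂ := green_hookIntegrand μ (c := 1) (by norm_num) (-1) (a + 1) r
  simp only [hookIntegrand_comm 1 (-1)] at h₂
  have hΓ : Continuous fun M : unitaryGroup (Fin n) ℂ =>
      trace (newtonGrad 1 (a + 1) M * newtonGrad (-1) r M) *
        (starRingEnd ℂ) (trace (M.1 ^ (a + 1 + r))) :=
    (((hasGrad_newtonTrace 1 (a + 1)).2.1.mul (hasGrad_newtonTrace (-1) r).2.1).matrix_trace).mul
      (HasGrad.trace_pow _).conj.1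
  have hI := fun k l => integrable_of_continuous μ (continuous_hookIntegrand (n := n) (-1) 1 k l)
  have h₃ : ∫ M, trace (newtonGrad (-1) (r + 1) M * newtonGrad 1 a M) *
        (starRingEnd ℂ) (trace (M.1 ^ (r + 1 + a))) ∂μ =
      ∫ M, trace (newtonGrad 1 (a + 1) M * newtonGrad (-1) r M) *
        (starRingEnd ℂ) (trace (M.1 ^ (a + 1 + r))) ∂μ -
      (r + 1) * ∫ M, hookIntegrand (-1) 1 (r + 1) a M ∂μ -
      (a + 1) * ∫ M, hookIntegrand (-1) 1 r (a + 1) M ∂μ := by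
    have hsub : Integrable (fun M => trace (newtonGrad 1 (a + 1) M * newtonGrad (-1) r M) *
        (starRingEnd ℂ) (trace (M.1 ^ (a + 1 + r))) -
        (r + 1) * hookIntegrand (-1) 1 (r + 1) a M) μ :=
      (integrable_of_continuous μ hΓ).sub ((hI _ _).const_mul _)
    rw [← integral_const_mul, ← integral_const_mul,
      ← integral_sub (integrable_of_continuous μ hΓ) ((hI _ _).const_mul _),
      ← integral_sub hsub ((hI _ _).const_mul _)]
    congr 1
    funext M
    rw [hookIntegrand, hookIntegrand, trace_mul_comm (newtonGrad 1 (a + 1) M),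
      show a + 1 + r = r + 1 + a by ring, show r + (a + 1) = r + 1 + a by ring]
    linear_combination (starRingEnd ℂ) (trace (M.1 ^ (r + 1 + a))) * trace_newtonGrad_succ_mul r a M
  push_cast at h₁ h₂
  linear_combination h₁ - h₂ - h₃

/-- Pairing of the products `(-1) ^ r * e r * h a` with the power sum of the same degree. -/
lemma integral_hookIntegrand {r : ℕ} (hr : r < n) (a : ℕ) :
    ∫ M, hookIntegrand (-1) 1 r a M ∂μ =
      if r = 0 then (if a = 0 then (n : ℂ) else 1) else if a = 0 then -1 else 0 := by
  induction r using Nat.strong_induction_on generalizing a with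
  | h r ih =>
    rcases r with _ | r
    · induction a using Nat.strong_induction_on with
      | h a iha =>
        rcases a with _ | a
        · simp [hookIntegrand, newtonTrace_zero]
        · have h := green_hookIntegrand μ (c := 1) (by norm_num) (-1) (a + 1) 0
          simp only [hookIntegrand_comm 1 (-1)] at h
          rw [Finset.sum_congr rfl fun k hk => iha k (Finset.mem_range.1 hk),
            Finset.sum_range_succ'] at h
          have hG : ∀ M : unitaryGroup (Fin n) ℂ, newtonGrad (-1) 0 M = 0 :=
            fun M => by simp [newtonGrad]
          have hne : ((a : ℂ) + 1) * (n + a) ≠ 0 := by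
            exact_mod_cast (by positivity : (a + 1) * (n + a) ≠ 0)
          simp [hG] at h
          simp only [if_true, Nat.add_eq_zero_iff, one_ne_zero, and_false, if_false]
          apply mul_left_cancel₀ hne
          linear_combination h
    · have h := hookIntegral_recurrence μ r a
      have hne : ((r : ℂ) + 1) * (n - r - 1) ≠ 0 := by
        refine mul_ne_zero (Nat.cast_add_one_ne_zero r) ?_
        rw [sub_sub, sub_ne_zero]
        exact_mod_cast hr.ne'
      rw [ih r (by omega) (by omega) (a + 1),
        Finset.sum_congr rfl fun k hk => ih k (Finset.mem_range.1 hk)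
          ((Finset.mem_range.1 hk).trans hr) a,
        Finset.sum_congr rfl fun l _ => ih r (by omega) (by omega) l,
        Finset.sum_range_succ', Finset.sum_range_succ'] at h
      apply mul_left_cancel₀ hne
      rw [h]
      rcases Nat.eq_zero_or_pos a with rfl | ha <;> rcases Nat.eq_zero_or_pos r with rfl | hr'
      · simp
      · simp [hr'.ne', -mul_eq_mul_left_iff, -mul_eq_mul_right_iff, -mul_neg]; ring
      · simp [ha.ne']; ring
      · simp [ha.ne', hr'.ne']

/-- The elementary symmetric functions of degree larger than `n` vanish almost everywhere: they
would be Laplace eigenfunctions with an eigenvalue of the wrong sign. -/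
lemma newtonTrace_neg_one_ae_eq_zero {r : ℕ} (hr : n < r) :
    ∀ᵐ M ∂μ, newtonTrace (n := n) (-1) r M = 0 := by
  have hs := hasGrad_newtonTrace (n := n) (-1) r
  have h := integral_newtonTrace_mul_add μ (c := -1) (by norm_num) r hs.conj
  set g : unitaryGroup (Fin n) ℂ → ℝ := fun M =>
    (r : ℝ) * (r - 1 - n) * Complex.normSq (newtonTrace (-1) r M) +
      ∑ x, ∑ y, Complex.normSq (newtonGrad (-1) r M x y) with hg
  have hfg : ∀ M : unitaryGroup (Fin n) ℂ,
      (r : ℂ) * (n + (-1) * (r - 1)) * newtonTrace (-1) r M *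
        (starRingEnd ℂ) (newtonTrace (-1) r M) +
        trace (newtonGrad (-1) r M * -(newtonGrad (-1) r M)ᴴ) = ((-g M : ℝ) : ℂ) := by
    intro M
    have htr : trace (newtonGrad (-1) r M * (newtonGrad (-1) r M)ᴴ) =
        ∑ x, ∑ y, (Complex.normSq (newtonGrad (-1) r M x y) : ℂ) := by
      simp [trace, mul_apply, Complex.mul_conj]
    rw [mul_neg, trace_neg, htr, mul_assoc _ (newtonTrace _ _ _), Complex.mul_conj, hg]
    push_cast
    ring
  simp only [hfg] at h
  rw [integral_complex_ofReal, Complex.ofReal_eq_zero, integral_neg, neg_eq_zero] at h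
  have hcoef : (0 : ℝ) ≤ (r : ℝ) * (r - 1 - n) := by
    have : (n : ℝ) + 1 ≤ r := by exact_mod_cast hr
    exact mul_nonneg (Nat.cast_nonneg r) (by linarith)
  have hsum : ∀ M : unitaryGroup (Fin n) ℂ,
      0 ≤ ∑ x, ∑ y, Complex.normSq (newtonGrad (-1) r M x y) := fun M =>
    Finset.sum_nonneg fun x _ => Finset.sum_nonneg fun y _ => Complex.normSq_nonneg _
  have hnonneg : 0 ≤ g := fun M =>
    add_nonneg (mul_nonneg hcoef (Complex.normSq_nonneg _)) (hsum M)
  have hcont : Continuous g := by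
    refine (continuous_const.mul (Complex.continuous_normSq.comp hs.1)).add
      (continuous_finsetSum _ fun x _ => continuous_finsetSum _ fun y _ =>
        Complex.continuous_normSq.comp (hs.2.1.matrix_elem x y))
  have hinteg : Integrable g μ :=
    hcont.integrable_of_hasCompactSupport (HasCompactSupport.of_compactSpace g)
  filter_upwards [(integral_eq_zero_iff_of_nonneg hnonneg hinteg).1 h] with M hM
  have hN : ∑ x, ∑ y, Complex.normSq (newtonGrad (-1) r M x y) = 0 :=
    ((add_eq_zero_iff_of_nonneg (mul_nonneg hcoef (Complex.normSq_nonneg _)) (hsum M)).1 hM).2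
  have hdiag : ∀ x, newtonGrad (-1) r M x x = 0 := by
    intro x
    have hx := (Finset.sum_eq_zero_iff_of_nonneg fun x _ =>
      Finset.sum_nonneg fun y _ => Complex.normSq_nonneg _).1 hN x (Finset.mem_univ x)
    exact Complex.normSq_eq_zero.1 ((Finset.sum_eq_zero_iff_of_nonneg fun y _ =>
      Complex.normSq_nonneg _).1 hx x (Finset.mem_univ x))
  have htrace := trace_newtonGrad (-1) r M
  have htrace_zero : trace (newtonGrad (-1) r M) = 0 := Finset.sum_eq_zero fun x _ => hdiag x
  rw [htrace_zero, eq_comm, mul_eq_zero] at htrace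
  exact htrace.resolve_left (Nat.cast_ne_zero.2 (by omega))

lemma integral_trace_pow_mul_conj_trace_pow_self {j : ℕ} (hj : 1 ≤ j) :
    ∫ M : unitaryGroup (Fin n) ℂ, trace (M.1 ^ j) * (starRingEnd ℂ) (trace (M.1 ^ j)) ∂μ =
      ((min j n : ℕ) : ℂ) := by
  have hexp : ∀ M : unitaryGroup (Fin n) ℂ,
      trace (M.1 ^ j) * (starRingEnd ℂ) (trace (M.1 ^ j)) =
        ∑ r ∈ Finset.range (j + 1), ((n : ℂ) - r) * hookIntegrand (-1) 1 r (j - r) M := by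
    intro M
    refine (congrArg (· * (starRingEnd ℂ) (trace (M.1 ^ j)))
      (sum_sub_mul_newtonCoeff (fun k => trace (M.1 ^ k)) n hj)).symm.trans ?_
    simp only [Finset.sum_mul]
    refine Finset.sum_congr rfl fun r hr => ?_
    rw [hookIntegrand, Nat.add_sub_cancel' (Nat.lt_succ_iff.1 (Finset.mem_range.1 hr))]
    simp only [newtonTrace]
    ring
  have hval : ∀ r : ℕ, r < j + 1 →
      ((n : ℂ) - r) * ∫ M, hookIntegrand (-1) 1 r (j - r) M ∂μ =
        if r = 0 then (n : ℂ) else if r = j then -((n - j : ℕ) : ℂ) else 0 := by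
    intro r hr
    rcases lt_trichotomy r n with hrn | rfl | hrn
    · rw [integral_hookIntegrand μ hrn]
      by_cases h0 : r = 0
      · subst h0
        simp [show j ≠ 0 by omega]
      · by_cases hrj : r = j
        · subst hrj
          simp [h0, Nat.cast_sub hrn.le]
        · simp [h0, hrj, show j - r ≠ 0 by omega]
    · by_cases h0 : r = 0
      · simp [h0]
      · by_cases hrj : r = j
        · simp [hrj, show j ≠ 0 by omega]
        · simp [h0, hrj]
    · have hz : ∫ M, hookIntegrand (n := n) (-1) 1 r (j - r) M ∂μ = 0 := by
        refine integral_eq_zero_of_ae ?_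
        filter_upwards [newtonTrace_neg_one_ae_eq_zero μ hrn] with M hM
        simp [hookIntegrand, hM]
      rw [hz, mul_zero]
      by_cases hrj : r = j
      · subst hrj
        simp [show r ≠ 0 by omega, Nat.sub_eq_zero_of_le hrn.le]
      · simp [show r ≠ 0 by omega, hrj]
  simp only [hexp]
  rw [integral_finsetSum _ fun r _ => (integrable_of_continuous μ
    (continuous_hookIntegrand (n := n) (-1) 1 r (j - r))).const_mul _]
  simp only [integral_const_mul]
  rw [Finset.sum_congr rfl fun r hr => hval r (Finset.mem_range.1 hr), Finset.sum_range_succ']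
  obtain ⟨m, rfl⟩ : ∃ m, j = m + 1 := ⟨j - 1, by omega⟩
  have hmin : ((min (m + 1) n : ℕ) : ℂ) + ((n - (m + 1) : ℕ) : ℂ) = n := by
    exact_mod_cast (by omega : min (m + 1) n + (n - (m + 1)) = n)
  simp only [Nat.add_eq_zero_iff, one_ne_zero, and_false, if_false, if_true,
    Nat.add_right_cancel_iff, Finset.sum_ite_eq', Finset.mem_range, Nat.lt_succ_self]
  linear_combination -hmin

lemma integral_trace_pow_mul_conj_trace_pow_of_ne {i j : ℕ} (hij : i ≠ j) :
    ∫ M : unitaryGroup (Fin n) ℂ, trace (M.1 ^ i) * (starRingEnd ℂ) (trace (M.1 ^ j)) ∂μ = 0 := by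
  have h := ((HasGrad.trace_pow (n := n) i).mul
    (HasGrad.trace_pow j).conj).integral_trace_mul_eq_zero μ 1
  have hrw : ∀ M : unitaryGroup (Fin n) ℂ,
      trace (1 * ((starRingEnd ℂ) (trace (M.1 ^ j)) • (i : ℂ) • M.1 ^ i +
        trace (M.1 ^ i) • -((j : ℂ) • M.1 ^ j)ᴴ)) =
      ((i : ℂ) - j) * (trace (M.1 ^ i) * (starRingEnd ℂ) (trace (M.1 ^ j))) := by
    intro M
    simp only [one_mul, trace_add, trace_smul, trace_neg, conjTranspose_smul, trace_conjTranspose,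
      star_natCast, smul_eq_mul, starRingEnd_apply]
    ring
  simp only [hrw, integral_const_mul] at h
  exact (mul_eq_zero.1 h).resolve_left (sub_ne_zero.2 (Nat.cast_injective.ne hij))

end NewtonTrace
end HaarUnitary

/-- If `M` is Haar distributed on `U(n)` and `i, j ≥ 1`, then
`E[Tr(M^i) conj(Tr(M^j))] = δ_{ij} · min(j, n)`. -/
theorem haar_unitary_trace_pow_mul_conj_trace_pow (n : ℕ)
    [MeasurableSpace (Matrix.unitaryGroup (Fin n) ℂ)]
    [BorelSpace (Matrix.unitaryGroup (Fin n) ℂ)]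
    (μ : Measure (Matrix.unitaryGroup (Fin n) ℂ))
    [IsProbabilityMeasure μ] [μ.IsMulLeftInvariant]
    (i j : ℕ) (hi : 1 ≤ i) (hj : 1 ≤ j) :
    ∫ M : Matrix.unitaryGroup (Fin n) ℂ,
        Matrix.trace ((M : Matrix (Fin n) (Fin n) ℂ) ^ i) *
          (starRingEnd ℂ) (Matrix.trace ((M : Matrix (Fin n) (Fin n) ℂ) ^ j)) ∂μ =
      if i = j then ((min j n : ℕ) : ℂ) else 0 := by
  split_ifs with hij
  · subst hij
    exact HaarUnitary.integral_trace_pow_mul_conj_trace_pow_self μ hj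
  · exact HaarUnitary.integral_trace_pow_mul_conj_trace_pow_of_ne μ hij
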